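/- For every M > 0 there exist constants C > 0 and N such that for all n ≥ N the following holds: if Q is an n×n real orthogonal matrix (Q·Qᵀ = I_n, so its rows have unit Euclidean norm) with |Q_ij| ≤ M/√n for all i, j, then |β(Q) − ( √(2·log(2n)) − log(log(2n))/(2·√(2·log(2n))) )| ≤ C/√(log n). -/

import Mathlib

open Finset

noncomputable section
open scoped Classical

/-- The sign `±1` associated to a Boolean. -/
def sgn (b : Bool) : ℝ := if b then 1 else -1

/-- The hypercube `{-1,1}^n` as a finite set of vectors in `ℝ^n`. -/
def cube (n : ℕ) : Finset (Fin n → ℝ) :=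
  (Finset.univ : Finset (Fin n → Bool)).image (fun ε i => sgn (ε i))

/-- `β(A) = 2^{-n} ∑_{x ∈ {-1,1}^n} ‖Ax‖_∞` (the `Pi` norm on `Fin n → ℝ` is the sup norm). -/
def badBeta {n : ℕ} (A : Matrix (Fin n) (Fin n) ℝ) : ℝ :=
  (2 ^ n : ℝ)⁻¹ * ∑ x ∈ cube n, ‖A.mulVec x‖

/-- The cell `S_i(A) = {x ∈ {-1,1}^n : ‖Ax‖_∞ = ⟨a_i, x⟩}`. -/
def cellS {n : ℕ} (A : Matrix (Fin n) (Fin n) ℝ) (i : Fin n) : Finset (Fin n → ℝ) :=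
  (cube n).filter (fun x => ‖A.mulVec x‖ = ∑ j, A i j * x j)

/-- `A` is tie-free: no two distinct rows attain the same absolute inner product with a
hypercube vertex. -/
def TieFree {n : ℕ} (A : Matrix (Fin n) (Fin n) ℝ) : Prop :=
  ∀ x ∈ cube n, ∀ i j : Fin n, i ≠ j →
    (∑ k, A i k * x k) ^ 2 ≠ (∑ k, A j k * x k) ^ 2

/-- Level-1 Fourier weight of `f : {-1,1}^n → ℝ`. -/
def W1 {n : ℕ} (f : (Fin n → ℝ) → ℝ) : ℝ :=
  ∑ i : Fin n, ((2 ^ n : ℝ)⁻¹ * ∑ x ∈ cube n, f x * x i) ^ 2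

open MeasureTheory ProbabilityTheory

lemma taylor3 (f f1 f2 f3 : ℝ → ℝ) (K : ℝ) (h0 : ∀ t, HasDerivAt f (f1 t) t)
    (h1 : ∀ t, HasDerivAt f1 (f2 t) t) (h2 : ∀ t, HasDerivAt f2 (f3 t) t)
    (hK : ∀ t, |f3 t| ≤ K) (t : ℝ) :
    |f t - f 0 - f1 0 * t - f2 0 / 2 * t ^ 2| ≤ K * |t| ^ 3 := by
  have key : ∀ (g g' : ℝ → ℝ) (B : ℝ), (∀ u, HasDerivAt g (g' u) u) →
      (∀ u ∈ Set.uIcc 0 t, |g' u| ≤ B) → ∀ u ∈ Set.uIcc 0 t, |g u - g 0| ≤ B * |t| := by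
    intro g g' B hg hB u hu
    have h := Convex.norm_image_sub_le_of_norm_hasDerivWithin_le (f := g) (f' := g') (C := B)
      (s := Set.uIcc 0 t) (fun x _ => (hg x).hasDerivWithinAt) (fun x hx => by simpa using hB x hx)
      (convex_uIcc 0 t) (Set.left_mem_uIcc) hu
    simp only [Real.norm_eq_abs, sub_zero] at h
    refine h.trans ?_
    have hB0 : 0 ≤ B := (abs_nonneg _).trans (hB u hu)
    have : |u| ≤ |t| := by
      have := Set.abs_sub_left_of_mem_uIcc hu
      simpa using this
    gcongr
  have e2 := key f2 f3 K h2 (fun u _ => hK u)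
  have e1 := key (fun u => f1 u - f2 0 * u) (fun u => f2 u - f2 0) (K * |t|)
    (fun u => ((h1 u).fun_sub ((hasDerivAt_id' u).const_mul (f2 0))).congr_deriv (by ring)) e2
  have e0 := key (fun u => f u - f1 0 * u - f2 0 / 2 * u ^ 2)
    (fun u => f1 u - f1 0 - f2 0 * u) (K * |t| * |t|)
    (fun u => (((h0 u).fun_sub ((hasDerivAt_id' u).const_mul (f1 0))).fun_sub
        ((hasDerivAt_pow 2 u).const_mul (f2 0 / 2))).congr_deriv (by push_cast; ring))
    (fun u hu => by
      have := e1 u hu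
      convert this using 2
      simp; ring) t Set.right_mem_uIcc
  convert e0 using 1
  · congr 1; simp; ring
  · ring

lemma lse_taylor {ι : Type*} [Fintype ι] [Nonempty ι] (c a : ι → ℝ) (s : ℝ)
    (hs : ∀ j, |a j| ≤ s) : ∃ h0 p q : ℝ, ∀ t,
    |Real.log (∑ j, Real.exp (c j + a j * t)) - h0 - p * t - q * t ^ 2| ≤ 6 * s ^ 3 * |t| ^ 3 := by
  have hs0 : 0 ≤ s := (abs_nonneg _).trans (hs (Classical.arbitrary ι))
  set S : ℕ → ℝ → ℝ := fun k t => ∑ j, a j ^ k * Real.exp (c j + a j * t) with hS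
  have hd : ∀ k t, HasDerivAt (S k) (S (k + 1) t) t := by
    intro k t
    simp only [hS]
    refine HasDerivAt.fun_sum fun j _ => ?_
    have : HasDerivAt (fun t => c j + a j * t) (a j) t := by
      simpa using ((hasDerivAt_id t).const_mul (a j)).const_add (c j)
    exact (this.exp.const_mul (a j ^ k)).congr_deriv (by ring)
  have hpos : ∀ t, 0 < S 0 t := by
    intro t
    simp only [hS, pow_zero, one_mul]
    exact Finset.sum_pos (fun j _ => Real.exp_pos _) Finset.univ_nonempty
  have hb : ∀ k t, |S k t / S 0 t| ≤ s ^ k := by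
    intro k t
    rw [abs_div, abs_of_pos (hpos t), div_le_iff₀ (hpos t)]
    simp only [hS, pow_zero, one_mul]
    rw [Finset.mul_sum]
    refine (Finset.abs_sum_le_sum_abs _ _).trans (Finset.sum_le_sum fun j _ => ?_)
    rw [abs_mul, abs_pow, Real.abs_exp]
    gcongr
    exact hs j
  have hr : ∀ k t, HasDerivAt (fun t => S k t / S 0 t)
      (S (k+1) t / S 0 t - (S k t / S 0 t) * (S 1 t / S 0 t)) t := by
    intro k t
    have := (hpos t).ne'
    refine ((hd k t).fun_div (hd 0 t) (hpos t).ne').congr_deriv ?_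
    field_simp
  refine ⟨Real.log (S 0 0), S 1 0 / S 0 0, (S 2 0 / S 0 0 - (S 1 0 / S 0 0) ^ 2) / 2, fun t => ?_⟩
  have := taylor3 (fun t => Real.log (S 0 t)) (fun t => S 1 t / S 0 t)
    (fun t => S 2 t / S 0 t - (S 1 t / S 0 t) ^ 2)
    (fun t => (S 3 t / S 0 t - (S 2 t / S 0 t) * (S 1 t / S 0 t)) -
      2 * (S 1 t / S 0 t) * (S 2 t / S 0 t - (S 1 t / S 0 t) * (S 1 t / S 0 t))) (6 * s ^ 3)
    (fun t => (hd 0 t).log (hpos t).ne') (fun t => (hr 1 t).congr_deriv (by ring)) (fun t =>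
      ((hr 2 t).fun_sub ((hr 1 t).fun_pow 2)).congr_deriv (by push_cast; ring)) (fun t => by
      have b1 := hb 1 t
      have b2 := hb 2 t
      have b3 := hb 3 t
      set x := S 1 t / S 0 t
      set y := S 2 t / S 0 t
      set z := S 3 t / S 0 t
      have hxy : |x * y| ≤ s ^ 3 := by
        rw [abs_mul]; calc _ ≤ s ^ 1 * s ^ 2 := by gcongr
          _ = _ := by ring
      have hxx : |x * x * x| ≤ s ^ 3 := by
        rw [abs_mul, abs_mul]; calc _ ≤ s ^ 1 * s ^ 1 * s ^ 1 := by gcongr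
          _ = _ := by ring
      rw [abs_le] at *
      constructor <;> nlinarith) t
  simpa [hS] using this

/-- Log-sum-exp of affine forms. -/
def LSE {ι : Type*} [Fintype ι] {n : ℕ} (c : ι → ℝ) (A : ι → Fin n → ℝ) (x : Fin n → ℝ) : ℝ :=
  Real.log (∑ j, Real.exp (c j + ∑ k, A j k * x k))

/-- Average over the hypercube. -/
def Avg (n : ℕ) (F : (Fin n → ℝ) → ℝ) : ℝ :=
  (2 ^ n : ℝ)⁻¹ * ∑ ε : Fin n → Bool, F (fun i => sgn (ε i))

lemma sgn_true : sgn true = 1 := by simp [sgn]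
lemma sgn_false : sgn false = -1 := by simp [sgn]

lemma sum_cube (n : ℕ) (F : (Fin n → ℝ) → ℝ) :
    (2 ^ n : ℝ)⁻¹ * ∑ x ∈ cube n, F x = Avg n F := by
  unfold cube Avg
  rw [Finset.sum_image]
  intro a _ b _ hab
  funext i
  have := congrFun hab i
  simp only [sgn] at this
  generalize a i = p at *
  generalize b i = q at *
  cases p <;> cases q <;> simp at * <;> norm_num at this

lemma Avg_succ (n : ℕ) (F : (Fin (n+1) → ℝ) → ℝ) :
    Avg (n+1) F = (Avg n (fun y => F (Fin.cons 1 y)) + Avg n (fun y => F (Fin.cons (-1) y))) / 2 := by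
  unfold Avg
  have : ∑ ε : Fin (n+1) → Bool, F (fun i => sgn (ε i)) =
      ∑ p : Bool × (Fin n → Bool), F (Fin.cons (sgn p.1) (fun i => sgn (p.2 i))) := by
    symm
    refine Fintype.sum_equiv (Fin.consEquiv (fun _ => Bool)) _ _ fun p => ?_
    congr 1
    funext i
    refine Fin.cases ?_ (fun i => ?_) i <;> simp [Fin.consEquiv]
  rw [this, Fintype.sum_prod_type]
  simp [sgn_true, sgn_false]
  rw [pow_succ]
  field_simp

abbrev γ : Measure ℝ := gaussianReal 0 1
abbrev γn (n : ℕ) : Measure (Fin n → ℝ) := Measure.pi (fun _ => γ)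

lemma integrable_coord (n : ℕ) (k : Fin n) : Integrable (fun x : Fin n → ℝ => x k) (γn n) := by
  have h : Integrable (id : ℝ → ℝ) γ := (memLp_id_gaussianReal 1).integrable le_rfl
  exact (measurePreserving_eval (fun _ : Fin n => γ) k).integrable_comp_of_integrable h

lemma LSE_cont {ι : Type*} [Fintype ι] [Nonempty ι] {n : ℕ} (c : ι → ℝ) (A : ι → Fin n → ℝ) :
    Continuous (LSE c A) := by
  unfold LSE
  refine Continuous.log (by fun_prop) fun x => ?_
  exact (Finset.sum_pos (fun j _ => Real.exp_pos _) Finset.univ_nonempty).ne'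

lemma LSE_integrable {ι : Type*} [Fintype ι] [Nonempty ι] {n : ℕ} (c : ι → ℝ)
    (A : ι → Fin n → ℝ) : Integrable (LSE c A) (γn n) := by
  have hu : ∀ j, Integrable (fun x : Fin n → ℝ => c j + ∑ k, A j k * x k) (γn n) := fun j =>
    (integrable_const _).add (integrable_finsetSum _ fun k _ => (integrable_coord n k).const_mul _)
  have hU : Integrable (fun x : Fin n → ℝ => Real.log (Fintype.card ι) +
      ∑ j, |c j + ∑ k, A j k * x k|) (γn n) :=
    (integrable_const _).add (integrable_finsetSum _ fun j _ => (hu j).abs)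
  refine hU.mono' (LSE_cont c A).aestronglyMeasurable (Filter.Eventually.of_forall fun x => ?_)
  rw [Real.norm_eq_abs]
  unfold LSE
  set u : ι → ℝ := fun j => c j + ∑ k, A j k * x k
  have hcard : (1:ℝ) ≤ Fintype.card ι := by exact_mod_cast Fintype.card_pos
  have hlc : 0 ≤ Real.log (Fintype.card ι) := Real.log_nonneg hcard
  have hle : ∀ j, |u j| ≤ ∑ j, |u j| := fun j =>
    Finset.single_le_sum (f := fun j => |u j|) (fun _ _ => abs_nonneg _) (Finset.mem_univ j)
  have hpos : 0 < ∑ j, Real.exp (u j) :=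
    Finset.sum_pos (fun j _ => Real.exp_pos _) Finset.univ_nonempty
  rw [abs_le]
  constructor
  · let j := Classical.arbitrary ι
    have h1 : Real.exp (u j) ≤ ∑ j, Real.exp (u j) :=
      Finset.single_le_sum (f := fun j => Real.exp (u j)) (fun _ _ => (Real.exp_pos _).le)
        (Finset.mem_univ j)
    have := Real.log_le_log (Real.exp_pos _) h1
    rw [Real.log_exp] at this
    have h2 := neg_abs_le (u j)
    have h3 := hle j
    change _ ≤ Real.log (∑ j, Real.exp (u j))
    change -(Real.log (Fintype.card ι) + ∑ j, |u j|) ≤ _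
    linarith
  · rw [Real.log_le_iff_le_exp hpos, Real.exp_add, Real.exp_log (by linarith)]
    calc ∑ j, Real.exp (u j) ≤ ∑ _j : ι, Real.exp (∑ j, |u j|) :=
          Finset.sum_le_sum fun j _ => Real.exp_le_exp.2 ((le_abs_self _).trans (hle j))
      _ = _ := by simp [u]

lemma LSE_cons {ι : Type*} [Fintype ι] {n : ℕ} (c : ι → ℝ)
    (A : ι → Fin (n+1) → ℝ) (t : ℝ) (y : Fin n → ℝ) :
    LSE c A (Fin.cons t y) = LSE (fun j => c j + A j 0 * t) (fun j k => A j k.succ) y := by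
  simp [LSE, Fin.sum_univ_succ, add_assoc]

lemma integrable_abs3 : Integrable (fun t : ℝ => |t| ^ 3) γ := by
  have := (memLp_id_gaussianReal (μ := 0) (v := 1) 3).integrable_norm_pow (by norm_num)
  simpa using this

/-- Swap constant. -/
def m3 : ℝ := ∫ t, |t| ^ 3 ∂γ

lemma one_dim (h : ℝ → ℝ) (hc : Continuous h) (h0 p q K : ℝ)
    (H : ∀ t, |h t - h0 - p * t - q * t ^ 2| ≤ K * |t| ^ 3) :
    |∫ t, h t ∂γ - (h 1 + h (-1)) / 2| ≤ K * (m3 + 1) := by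
  have i1 : Integrable (fun t : ℝ => t) γ := (memLp_id_gaussianReal 1).integrable le_rfl
  have i2 : Integrable (fun t : ℝ => t ^ 2) γ := by
    have := (memLp_id_gaussianReal (μ := 0) (v := 1) 2).integrable_sq
    simpa using this
  have e1 : ∫ t, t ∂γ = 0 := integral_id_gaussianReal
  have e2 : ∫ t, t ^ 2 ∂γ = 1 := by
    have h1 := variance_id_gaussianReal (μ := 0) (v := 1)
    rw [variance_eq_integral (by fun_prop)] at h1
    simpa [integral_id_gaussianReal] using h1
  have iP : Integrable (fun t : ℝ => h0 + p * t + q * t ^ 2) γ :=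
    ((integrable_const _).add (i1.const_mul p)).add (i2.const_mul q)
  have iR : Integrable (fun t : ℝ => h t - h0 - p * t - q * t ^ 2) γ :=
    (integrable_abs3.const_mul K).mono' (by fun_prop) (Filter.Eventually.of_forall H)
  have eP : ∫ t, (h0 + p * t + q * t ^ 2) ∂γ = h0 + q := by
    have i3 : Integrable (fun t : ℝ => h0 + p * t) γ := (integrable_const _).add (i1.const_mul p)
    rw [integral_add i3 (i2.const_mul q),
      integral_add (integrable_const _) (i1.const_mul p), integral_const_mul, integral_const_mul,
      e1, e2]
    simp
  have eh : ∫ t, h t ∂γ = (h0 + q) + ∫ t, (h t - h0 - p * t - q * t ^ 2) ∂γ := by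
    rw [← eP, ← integral_add iP iR]
    congr 1; funext t; ring
  have hR : |∫ t, (h t - h0 - p * t - q * t ^ 2) ∂γ| ≤ K * m3 := by
    rw [m3, ← integral_const_mul]
    exact norm_integral_le_of_norm_le (f := fun t => h t - h0 - p * t - q * t ^ 2)
      (integrable_abs3.const_mul K) (Filter.Eventually.of_forall H)
  have a1 := H 1
  have a2 := H (-1)
  simp only [abs_neg, abs_one] at a1 a2
  rw [eh]
  rw [abs_le] at *
  constructor <;> linarith [hR.1, hR.2, a1.1, a1.2, a2.1, a2.2]

lemma lindeberg {ι : Type*} [Fintype ι] [Nonempty ι] (s : ℝ) : ∀ (n : ℕ) (c : ι → ℝ)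
    (A : ι → Fin n → ℝ), (∀ j k, |A j k| ≤ s) →
    |∫ x, LSE c A x ∂(γn n) - Avg n (LSE c A)| ≤ n * (6 * s ^ 3 * (m3 + 1)) := by
  intro n
  induction n with
  | zero =>
    intro c A _
    have : ∀ x : Fin 0 → ℝ, LSE c A x = LSE c A 0 := fun x => by rw [Subsingleton.elim x 0]
    simp [Avg, this]
  | succ n ih =>
    intro c A hA
    have mp := (measurePreserving_piFinSuccAbove (fun _ : Fin (n+1) => γ) 0).symm
    have hI : Integrable (fun p : ℝ × (Fin n → ℝ) => LSE c A (Fin.cons p.1 p.2))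
        (γ.prod (γn n)) := by
      have := (mp.integrable_comp_emb (MeasurableEquiv.measurableEmbedding _)
        (g := LSE c A)).2 (LSE_integrable c A)
      refine this.congr (Filter.Eventually.of_forall fun p => ?_)
      simp [MeasurableEquiv.piFinSuccAbove, Fin.consEquiv]
    have hE : ∫ x, LSE c A x ∂(γn (n+1)) =
        ∫ y, ∫ t, LSE c A (Fin.cons t y) ∂γ ∂(γn n) := by
      rw [← integral_prod_symm (f := fun p : ℝ × (Fin n → ℝ) => LSE c A (Fin.cons p.1 p.2)) hI]
      rw [← mp.integral_comp']
      congr 1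
      funext p
      simp [MeasurableEquiv.piFinSuccAbove, Fin.consEquiv]
    have hcons : ∀ t, (fun y : Fin n → ℝ => LSE c A (Fin.cons t y)) =
        LSE (fun j => c j + A j 0 * t) (fun j k => A j k.succ) := fun t => by
      funext y; exact LSE_cons c A t y
    have hp := ih (fun j => c j + A j 0 * 1) (fun j k => A j k.succ) (fun j k => hA j k.succ)
    have hm := ih (fun j => c j + A j 0 * (-1)) (fun j k => A j k.succ) (fun j k => hA j k.succ)
    rw [← hcons] at hp hm
    have ip : Integrable (fun y : Fin n → ℝ => LSE c A (Fin.cons 1 y)) (γn n) := by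
      rw [hcons]; exact LSE_integrable _ _
    have im : Integrable (fun y : Fin n → ℝ => LSE c A (Fin.cons (-1) y)) (γn n) := by
      rw [hcons]; exact LSE_integrable _ _
    have hpt : ∀ y : Fin n → ℝ, |∫ t, LSE c A (Fin.cons t y) ∂γ -
        (LSE c A (Fin.cons 1 y) + LSE c A (Fin.cons (-1) y)) / 2| ≤ 6 * s ^ 3 * (m3 + 1) := by
      intro y
      obtain ⟨h0, p, q, H⟩ := lse_taylor (fun j => c j + ∑ k : Fin n, A j k.succ * y k)
        (fun j => A j 0) s (fun j => hA j 0)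
      refine one_dim (fun t => LSE c A (Fin.cons t y)) ?_ h0 p q _ fun t => ?_
      · exact (LSE_cont c A).comp (by fun_prop)
      · convert H t using 6
        simp only [LSE]
        congr 1
        refine Finset.sum_congr rfl fun j _ => ?_
        congr 1
        simp [Fin.sum_univ_succ]; ring
    have hd : |∫ y, ∫ t, LSE c A (Fin.cons t y) ∂γ ∂(γn n) -
        (∫ y, LSE c A (Fin.cons 1 y) ∂(γn n) + ∫ y, LSE c A (Fin.cons (-1) y) ∂(γn n)) / 2| ≤
        6 * s ^ 3 * (m3 + 1) := by
      have i4 : Integrable (fun y : Fin n → ℝ => (LSE c A (Fin.cons 1 y) +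
        LSE c A (Fin.cons (-1) y)) / 2) (γn n) := (ip.add im).div_const 2
      have i5 : Integrable (fun y : Fin n → ℝ => ∫ t, LSE c A (Fin.cons t y) ∂γ) (γn n) :=
        hI.integral_prod_right
      rw [← integral_add ip im, ← integral_div, ← integral_sub i5 i4]
      have := norm_integral_le_of_norm_le_const (μ := γn n)
        (f := fun y => ∫ t, LSE c A (Fin.cons t y) ∂γ -
        (LSE c A (Fin.cons 1 y) + LSE c A (Fin.cons (-1) y)) / 2) (Filter.Eventually.of_forall hpt)
      simpa using this
    rw [hE, Avg_succ]
    push_cast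
    rw [abs_le] at *
    constructor <;> linarith [hp.1, hp.2, hm.1, hm.2, hd.1, hd.2]

lemma softmax_bounds {n : ℕ} (hn : 0 < n) (Q : Matrix (Fin n) (Fin n) ℝ) (B : ℝ) (hB : 0 < B)
    (x : Fin n → ℝ) :
    B * ‖Q.mulVec x‖ ≤ LSE (ι := Fin n × Bool) (fun _ => 0) (fun p k => sgn p.2 * B * Q p.1 k) x ∧
    LSE (ι := Fin n × Bool) (fun _ => 0) (fun p k => sgn p.2 * B * Q p.1 k) x ≤
      B * ‖Q.mulVec x‖ + Real.log (2 * n) := by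
  have : Nonempty (Fin n) := ⟨⟨0, hn⟩⟩
  have hu : ∀ p : Fin n × Bool, (0:ℝ) + ∑ k, sgn p.2 * B * Q p.1 k * x k =
      sgn p.2 * (B * Q.mulVec x p.1) := by
    intro p
    simp only [Matrix.mulVec, dotProduct, Finset.mul_sum, zero_add]
    exact Finset.sum_congr rfl fun k _ => by ring
  unfold LSE
  simp only [hu]
  set y := Q.mulVec x
  have hpos : 0 < ∑ p : Fin n × Bool, Real.exp (sgn p.2 * (B * y p.1)) :=
    Finset.sum_pos (fun j _ => Real.exp_pos _) Finset.univ_nonempty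
  have hsingle : ∀ p : Fin n × Bool, sgn p.2 * (B * y p.1) ≤
      Real.log (∑ p : Fin n × Bool, Real.exp (sgn p.2 * (B * y p.1))) := by
    intro p
    rw [Real.le_log_iff_exp_le hpos]
    exact Finset.single_le_sum (f := fun p : Fin n × Bool => Real.exp (sgn p.2 * (B * y p.1)))
      (fun _ _ => (Real.exp_pos _).le) (Finset.mem_univ p)
  have hn' : (1:ℝ) ≤ n := by exact_mod_cast hn
  constructor
  · rw [mul_comm, ← le_div_iff₀ hB]
    rw [pi_norm_le_iff_of_nonempty]
    intro i
    rw [Real.norm_eq_abs, le_div_iff₀ hB]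
    have h1 := hsingle (i, true)
    have h2 := hsingle (i, false)
    simp only [sgn_true, sgn_false] at h1 h2
    rcases abs_cases (y i) with h | h <;> rw [h.1] <;> linarith
  · rw [Real.log_le_iff_le_exp hpos, Real.exp_add, Real.exp_log (by linarith)]
    calc _ ≤ ∑ _p : Fin n × Bool, Real.exp (B * ‖y‖) := by
          refine Finset.sum_le_sum fun p _ => Real.exp_le_exp.2 ?_
          have h3 : |y p.1| ≤ ‖y‖ := norm_le_pi_norm y p.1
          have h4 : B * y p.1 ≤ B * ‖y‖ := by gcongr; exact (le_abs_self _).trans h3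
          have h5 : B * (-y p.1) ≤ B * ‖y‖ := by gcongr; exact (neg_le_abs _).trans h3
          obtain ⟨i, b⟩ := p
          cases b <;> simp only [sgn_true, sgn_false] <;> linarith
      _ = _ := by simp; ring

lemma gauss_rot {n : ℕ} (Q : Matrix (Fin n) (Fin n) ℝ) (hQ : Q * Q.transpose = 1) :
    ∫ x, ‖Q.mulVec x‖ ∂(γn n) = ∫ x, ‖x‖ ∂(γn n) := by
  have hQ' : Q.transpose * Q = 1 := mul_eq_one_comm.1 hQ
  let f : EuclideanSpace ℝ (Fin n) →ₗᵢ[ℝ] EuclideanSpace ℝ (Fin n) :=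
    { toLinearMap := Matrix.toLpLin 2 2 Q
      norm_map' := fun x => by
        rw [Matrix.toLpLin_apply]
        have : ‖WithLp.toLp 2 (Q.mulVec x.ofLp)‖ ^ 2 = ‖x‖ ^ 2 := by
          rw [EuclideanSpace.real_norm_sq_eq, EuclideanSpace.real_norm_sq_eq]
          have h1 : Q.mulVec x.ofLp ⬝ᵥ Q.mulVec x.ofLp = x.ofLp ⬝ᵥ x.ofLp := by
            rw [Matrix.dotProduct_mulVec, Matrix.vecMul_mulVec, hQ', Matrix.vecMul_one]
          simpa [dotProduct, sq] using h1
        exact (sq_eq_sq₀ (norm_nonneg _) (norm_nonneg _)).1 this }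
  let e := f.toLinearIsometryEquiv rfl
  have h1 := stdGaussian_map e
  rw [← map_pi_eq_stdGaussian] at h1
  have key : ∀ g : EuclideanSpace ℝ (Fin n) → ℝ, Continuous g →
      ∫ x, g (e (WithLp.toLp 2 x)) ∂(γn n) = ∫ x, g (WithLp.toLp 2 x) ∂(γn n) := by
    intro g hg
    have h2 := congrArg (fun μ => ∫ x, g x ∂μ) h1
    rw [integral_map (by fun_prop) (by fun_prop), integral_map (by fun_prop) (by
      have := hg.comp e.continuous
      exact this.aestronglyMeasurable), integral_map (by fun_prop) (by fun_prop)] at h2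
    exact h2
  have := key (fun v => ‖v.ofLp‖) (by fun_prop)
  simpa [e, f, Matrix.toLpLin_apply] using this

lemma norm_integrable (n : ℕ) : Integrable (fun x : Fin n → ℝ => ‖x‖) (γn n) := by
  have : Integrable (fun x : Fin n → ℝ => ∑ k, |x k|) (γn n) :=
    integrable_finsetSum _ fun k _ => (integrable_coord n k).abs
  refine this.mono' (by fun_prop) (Filter.Eventually.of_forall fun x => ?_)
  rw [norm_norm, pi_norm_le_iff_of_nonneg (Finset.sum_nonneg fun _ _ => abs_nonneg _)]
  intro i
  exact Finset.single_le_sum (f := fun k => |x k|) (fun _ _ => abs_nonneg _) (Finset.mem_univ i)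

lemma tail_pos (t : ℝ) (ht : 0 < t) :
    ∫ x, max (x - t) 0 ∂γ ≤ Real.exp (-t ^ 2 / 2) / t ^ 2 := by
  rw [integral_gaussianReal_eq_integral_smul (by norm_num)]
  rw [← integral_add_right_eq_self _ t]
  have hint : IntegrableOn (fun u : ℝ => u * Real.exp (-(t * u))) (Set.Ioi 0) := by
    have := integrableOn_rpow_mul_exp_neg_mul_rpow (p := 1) (s := 1) (b := t) (by norm_num)
      (by norm_num) ht
    simpa using this
  have hval : ∫ u in Set.Ioi (0:ℝ), u * Real.exp (-(t * u)) = 1 / t ^ 2 := by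
    have := Real.integral_rpow_mul_exp_neg_mul_Ioi (a := 2) (r := t) (by norm_num) ht
    norm_num at this
    rw [this]; simp
  have hle : ∫ u, Set.indicator (Set.Ioi 0)
      (fun u : ℝ => Real.exp (-t ^ 2 / 2) * (u * Real.exp (-(t * u)))) u =
      Real.exp (-t ^ 2 / 2) / t ^ 2 := by
    rw [integral_indicator measurableSet_Ioi, integral_const_mul, hval]
    ring
  rw [← hle]
  refine integral_mono_of_nonneg (Filter.Eventually.of_forall fun u => ?_)
    ((integrable_indicator_iff measurableSet_Ioi).2 (hint.const_mul _))
    (Filter.Eventually.of_forall fun u => ?_)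
  · exact mul_nonneg (gaussianPDFReal_nonneg _ _ _) (le_max_right _ _)
  · simp only [smul_eq_mul, add_sub_cancel_right]
    by_cases hu : 0 < u
    · rw [Set.indicator_of_mem (by exact hu), max_eq_left hu.le]
      have h1 : gaussianPDFReal 0 1 (u + t) ≤ Real.exp (-t ^ 2 / 2) * Real.exp (-(t * u)) := by
        unfold gaussianPDFReal
        rw [← Real.exp_add]
        have h2 : (√(2 * Real.pi * ((1:NNReal):ℝ)))⁻¹ ≤ 1 := by
          apply inv_le_one_of_one_le₀
          rw [Real.one_le_sqrt]
          have := Real.pi_gt_three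
          simp; linarith
        calc _ ≤ 1 * Real.exp (-(u + t - 0) ^ 2 / (2 * ((1:NNReal):ℝ))) := by gcongr
          _ ≤ _ := by
            rw [one_mul]
            apply Real.exp_le_exp.2
            simp
            nlinarith [sq_nonneg u]
      calc _ ≤ (Real.exp (-t ^ 2 / 2) * Real.exp (-(t * u))) * u := by gcongr
        _ = _ := by ring
    · rw [Set.indicator_of_notMem (by exact hu), max_eq_right (not_lt.1 hu)]
      simp

lemma tail_abs (t : ℝ) (ht : 0 < t) :
    Integrable (fun x => max (|x| - t) 0) γ ∧
    ∫ x, max (|x| - t) 0 ∂γ ≤ 2 * (Real.exp (-t ^ 2 / 2) / t ^ 2) := by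
  have i1 : Integrable (fun t : ℝ => t) γ := (memLp_id_gaussianReal 1).integrable le_rfl
  have j1 : Integrable (fun x => max (x - t) 0) γ :=
    (i1.sub (integrable_const t)).sup (integrable_const 0)
  have j2 : Integrable (fun x => max (-x - t) 0) γ :=
    (i1.neg.sub (integrable_const t)).sup (integrable_const 0)
  have j3 : Integrable (fun x => max (|x| - t) 0) γ :=
    (i1.abs.sub (integrable_const t)).sup (integrable_const 0)
  refine ⟨j3, ?_⟩
  have h2 : ∫ x, max (-x - t) 0 ∂γ = ∫ x, max (x - t) 0 ∂γ := by
    have h3 : Measure.map (fun x => -x) γ = γ := by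
      have := gaussianReal_map_neg (μ := 0) (v := 1)
      simpa using this
    conv_rhs => rw [← h3]
    rw [integral_map (by fun_prop) (by fun_prop)]
  have h4 : ∫ x, max (|x| - t) 0 ∂γ ≤ ∫ x, (max (x - t) 0 + max (-x - t) 0) ∂γ := by
    refine integral_mono j3 (j1.add j2) fun x => ?_
    simp only
    rcases abs_cases x with h | h <;> rw [h.1]
    · exact le_add_of_nonneg_right (le_max_right _ _)
    · exact le_add_of_nonneg_left (le_max_right _ _)
  rw [integral_add j1 j2, h2] at h4
  linarith [tail_pos t ht]

lemma gauss_upper (n : ℕ) (t : ℝ) (ht : 0 < t) :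
    ∫ x, ‖x‖ ∂(γn n) ≤ t + n * (2 * (Real.exp (-t ^ 2 / 2) / t ^ 2)) := by
  obtain ⟨hi, hl⟩ := tail_abs t ht
  have hk : ∀ k : Fin n, Integrable (fun x : Fin n → ℝ => max (|x k| - t) 0) (γn n) := fun k =>
    (measurePreserving_eval (fun _ : Fin n => γ) k).integrable_comp_of_integrable hi
  have hv : ∀ k : Fin n, ∫ x : Fin n → ℝ, max (|x k| - t) 0 ∂(γn n) = ∫ x, max (|x| - t) 0 ∂γ := by
    intro k
    have h := (measurePreserving_eval (fun _ : Fin n => γ) k)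
    rw [← h.map_eq, integral_map h.measurable.aemeasurable (by fun_prop)]
  have hs := integrable_finsetSum Finset.univ fun k _ => hk k
  calc ∫ x, ‖x‖ ∂(γn n) ≤ ∫ x : Fin n → ℝ, (t + ∑ k, max (|x k| - t) 0) ∂(γn n) := by
        refine integral_mono (norm_integrable n) ((integrable_const _).add hs) fun x => ?_
        simp only
        rw [pi_norm_le_iff_of_nonneg (add_nonneg ht.le (Finset.sum_nonneg fun _ _ => le_max_right _ _))]
        intro i
        have := Finset.single_le_sum (f := fun k => max (|x k| - t) 0)
          (fun _ _ => le_max_right _ _) (Finset.mem_univ i)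
        have h2 := le_max_left (|x i| - t) 0
        rw [Real.norm_eq_abs]
        linarith
    _ = t + n * ∫ x, max (|x| - t) 0 ∂γ := by
        rw [integral_add (integrable_const _) hs, integral_finsetSum _ fun k _ => hk k]
        simp [hv]
    _ ≤ _ := by gcongr

lemma ball_prob (n : ℕ) (hn : 0 < n) (t d E : ℝ) (ht : 0 ≤ t) (hd : 0 < d)
    (hE : (t + d) ^ 2 ≤ E) :
    (γn n).real {x | ‖x‖ ≤ t} ≤ √(2 * Real.pi) * Real.exp (E / 2) / (n * d) := by
  have hset : {x : Fin n → ℝ | ‖x‖ ≤ t} = Set.univ.pi (fun _ => Set.Icc (-t) t) := by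
    ext x
    simp only [Set.mem_ofPred_eq, Set.mem_univ_pi, pi_norm_le_iff_of_nonneg ht, Real.norm_eq_abs,
      abs_le, Set.mem_Icc]
  set q : ℝ := d * ((√(2 * Real.pi))⁻¹ * Real.exp (-E / 2)) with hq
  have hqpos : 0 < q := by positivity
  have hIoc : q ≤ γ.real (Set.Ioc t (t + d)) := by
    rw [Measure.real, gaussianReal_apply_eq_integral _ (by norm_num)]
    rw [ENNReal.toReal_ofReal (integral_nonneg fun _ => gaussianPDFReal_nonneg _ _ _)]
    have h := setIntegral_ge_of_const_le (μ := volume) (f := gaussianPDFReal 0 1)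
      (s := Set.Ioc t (t + d)) (c := (√(2 * Real.pi))⁻¹ * Real.exp (-E / 2)) measurableSet_Ioc
      (by simp) (fun x hx => ?_) (integrable_gaussianPDFReal 0 1).integrableOn
    · have hv : volume.real (Set.Ioc t (t + d)) = d := by simp [Measure.real, hd.le]
      rw [hv] at h
      exact h
    · unfold gaussianPDFReal
      simp only [NNReal.coe_one, mul_one, sub_zero]
      gcongr
      refine le_trans ?_ hE
      have h0 : 0 ≤ x := ht.trans hx.1.le
      have := hx.2
      gcongr
  have hIcc : γ.real (Set.Icc (-t) t) ≤ 1 - q := by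
    have hdis : Disjoint (Set.Icc (-t) t) (Set.Ioc t (t + d)) := by
      rw [Set.disjoint_left]
      intro x hx hx'
      exact absurd hx.2 (not_le.2 hx'.1)
    have h1 := measureReal_union (μ := γ) hdis measurableSet_Ioc
    have h2 : γ.real (Set.Icc (-t) t ∪ Set.Ioc t (t + d)) ≤ 1 := measureReal_le_one
    linarith
  have hn' : (0:ℝ) < n := by exact_mod_cast hn
  calc (γn n).real {x | ‖x‖ ≤ t} = (γ.real (Set.Icc (-t) t)) ^ n := by
        rw [hset, Measure.real, Measure.pi_pi]
        simp [Measure.real]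
    _ ≤ (Real.exp (-q)) ^ n := by
        gcongr
        exact hIcc.trans (by linarith [Real.add_one_le_exp (-q)])
    _ = (Real.exp (n * q))⁻¹ := by rw [← Real.exp_nat_mul, ← Real.exp_neg]; congr 1; ring
    _ ≤ (n * q)⁻¹ := by
        gcongr
        linarith [Real.add_one_le_exp (n * q)]
    _ = _ := by
        rw [hq, show -E / 2 = -(E/2) by ring, Real.exp_neg]
        field_simp

lemma gauss_lower (n : ℕ) (hn : 0 < n) (b : ℝ) (hb : 1 ≤ b) :
    b - ∫ x, ‖x‖ ∂(γn n) ≤ 3 * √(2 * Real.pi) * Real.exp (b ^ 2 / 2 + 3 / 2) / n := by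
  have hb0 : 0 < b := by linarith
  have hn' : (0:ℝ) < n := by exact_mod_cast hn
  set m := ⌊b ^ 2⌋₊ with hm
  have hms : ∀ t : ℝ, MeasurableSet {x : Fin n → ℝ | ‖x‖ ≤ t} := fun t =>
    measurableSet_le (by fun_prop) measurable_const
  have hii : ∀ k : ℕ, Integrable (fun x : Fin n → ℝ => Set.indicator
      {x : Fin n → ℝ | ‖x‖ ≤ b - k / b} (fun _ => (1:ℝ)) x) (γn n) := fun k =>
    (integrable_const 1).indicator (hms _)
  have hpt : ∀ x : Fin n → ℝ, b - ‖x‖ ≤ (1 / b) * ∑ k ∈ Finset.range (m + 1), Set.indicator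
      {x : Fin n → ℝ | ‖x‖ ≤ b - k / b} (fun _ => (1:ℝ)) x := by
    intro x
    have hnn : ∀ k ∈ Finset.range (m + 1), 0 ≤ Set.indicator
      {x : Fin n → ℝ | ‖x‖ ≤ b - k / b} (fun _ => (1:ℝ)) x := fun k _ =>
      Set.indicator_nonneg (fun _ _ => zero_le_one) _
    by_cases hx : b ≤ ‖x‖
    · have := mul_nonneg (one_div_nonneg.2 hb0.le) (Finset.sum_nonneg hnn)
      linarith
    · push Not at hx
      set r := ⌊b * (b - ‖x‖)⌋₊ with hr
      have hrm : r ≤ m := Nat.floor_le_floor (by nlinarith [norm_nonneg x])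
      have h1 : ∑ k ∈ Finset.range (r + 1), (1:ℝ) ≤ ∑ k ∈ Finset.range (m + 1), Set.indicator
          {x : Fin n → ℝ | ‖x‖ ≤ b - k / b} (fun _ => (1:ℝ)) x := by
        calc _ ≤ ∑ k ∈ Finset.range (r + 1), Set.indicator
              {x : Fin n → ℝ | ‖x‖ ≤ b - k / b} (fun _ => (1:ℝ)) x := by
              refine Finset.sum_le_sum fun k hk => ?_
              rw [Set.indicator_of_mem]
              have hk' : k ≤ r := Nat.lt_succ_iff.1 (Finset.mem_range.1 hk)
              have h2 : (k:ℝ) ≤ b * (b - ‖x‖) :=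
                (Nat.cast_le.2 hk').trans (Nat.floor_le (by nlinarith))
              have h3 : (k:ℝ) / b ≤ b - ‖x‖ := by rw [div_le_iff₀ hb0]; linarith
              show ‖x‖ ≤ b - k / b
              linarith
          _ ≤ _ := Finset.sum_le_sum_of_subset_of_nonneg
              (Finset.range_mono (by omega)) fun k hk _ => hnn k hk
      have h2 : b * (b - ‖x‖) ≤ r + 1 := (Nat.lt_floor_add_one _).le
      have h3 : b * (b - ‖x‖) ≤ ∑ k ∈ Finset.range (m + 1), Set.indicator
          {x : Fin n → ℝ | ‖x‖ ≤ b - k / b} (fun _ => (1:ℝ)) x := by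
        refine h2.trans (le_trans ?_ h1)
        simp
      rw [one_div, ← div_eq_inv_mul, le_div_iff₀ hb0]
      linarith
  have hInt : b - ∫ x, ‖x‖ ∂(γn n) ≤ (1 / b) * ∑ k ∈ Finset.range (m + 1),
      (γn n).real {x : Fin n → ℝ | ‖x‖ ≤ b - k / b} := by
    calc b - ∫ x, ‖x‖ ∂(γn n) = ∫ x, (b - ‖x‖) ∂(γn n) := by
          rw [integral_sub (integrable_const _) (norm_integrable n)]; simp
      _ ≤ ∫ x, ((1 / b) * ∑ k ∈ Finset.range (m + 1), Set.indicator
            {x : Fin n → ℝ | ‖x‖ ≤ b - k / b} (fun _ => (1:ℝ)) x) ∂(γn n) :=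
          integral_mono ((integrable_const _).sub (norm_integrable n))
            ((integrable_finsetSum _ fun k _ => hii k).const_mul _) hpt
      _ = _ := by
          rw [integral_const_mul, integral_finsetSum _ fun k _ => hii k]
          congr 1
          refine Finset.sum_congr rfl fun k _ => ?_
          rw [integral_indicator (hms _)]
          simp
  have hterm : ∀ k ∈ Finset.range (m + 1), (γn n).real {x : Fin n → ℝ | ‖x‖ ≤ b - k / b} ≤
      (√(2 * Real.pi) * Real.exp (b ^ 2 / 2 + 3 / 2) / n * b) * (2 / 3) ^ k := by
    intro k hk
    have hk' : k ≤ m := Nat.lt_succ_iff.1 (Finset.mem_range.1 hk)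
    have hkb : (k:ℝ) ≤ b ^ 2 := (Nat.cast_le.2 hk').trans (Nat.floor_le (by positivity))
    have hkb' : (k:ℝ) / b ≤ b := by rw [div_le_iff₀ hb0]; nlinarith
    have h1 := ball_prob n hn (b - k / b) (1 / b) (b ^ 2 - k + 3) (by linarith) (by positivity) (by
      have e1 : (b - k / b + 1 / b) ^ 2 = b ^ 2 - 2 * k + k * (k / b ^ 2) + 2 - 2 * (k / b ^ 2)
          + 1 / b ^ 2 := by
        field_simp; ring
      have e2 : (k:ℝ) / b ^ 2 ≤ 1 := by rw [div_le_one (by positivity)]; exact hkb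
      have e3 : 1 / b ^ 2 ≤ 1 := by
        rw [div_le_one (by positivity)]; nlinarith
      have e4 : 0 ≤ (k:ℝ) / b ^ 2 := by positivity
      have e5 : (k:ℝ) * (k / b ^ 2) ≤ k * 1 := by gcongr
      rw [e1]; linarith)
    refine h1.trans ?_
    have e6 : Real.exp ((b ^ 2 - k + 3) / 2) = Real.exp (b ^ 2 / 2 + 3 / 2) * Real.exp (-(1/2)) ^ k := by
      rw [← Real.exp_nat_mul, ← Real.exp_add]; congr 1; ring
    have e7 : Real.exp (-(1/2)) ≤ 2 / 3 := by
      rw [Real.exp_neg]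
      have := Real.add_one_le_exp (1/2)
      rw [show (2:ℝ)/3 = (3/2)⁻¹ by norm_num]
      gcongr
      linarith
    rw [e6]
    calc _ = (√(2 * Real.pi) * Real.exp (b ^ 2 / 2 + 3 / 2) / n * b) * Real.exp (-(1/2)) ^ k := by
          field_simp
      _ ≤ _ := by gcongr
  have hgeom : ∑ k ∈ Finset.range (m + 1), ((2:ℝ) / 3) ^ k ≤ 3 := by
    rw [geom_sum_eq (by norm_num)]
    have : (0:ℝ) ≤ (2/3) ^ (m+1) := by positivity
    rw [div_le_iff_of_neg (by norm_num)]
    linarith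
  calc _ ≤ _ := hInt
    _ ≤ (1 / b) * ∑ k ∈ Finset.range (m + 1),
        (√(2 * Real.pi) * Real.exp (b ^ 2 / 2 + 3 / 2) / n * b) * (2 / 3) ^ k := by
        gcongr with k hk
        exact hterm k hk
    _ = (√(2 * Real.pi) * Real.exp (b ^ 2 / 2 + 3 / 2) / n) *
        ∑ k ∈ Finset.range (m + 1), (2 / 3) ^ k := by
        rw [← Finset.mul_sum]; field_simp
    _ ≤ (√(2 * Real.pi) * Real.exp (b ^ 2 / 2 + 3 / 2) / n) * 3 := by gcongr
    _ = _ := by ring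

lemma gauss_asymp (n : ℕ) (hn : 0 < n) (L : ℝ) (hL : L = Real.log (2 * n)) (hL1 : 1 ≤ L) :
    |∫ x, ‖x‖ ∂(γn n) - (√(2 * L) - Real.log L / (2 * √(2 * L)))| ≤
      (1 + 6 * √(2 * Real.pi) * Real.exp (1 / 4 + 3 / 2)) / √L := by
  have hn' : (0:ℝ) < n := by exact_mod_cast hn
  have hL0 : 0 < L := by linarith
  set b := √(2 * L) - Real.log L / (2 * √(2 * L)) with hb
  have hs : √(2 * L) ^ 2 = 2 * L := Real.sq_sqrt (by linarith)
  have hsp : 0 < √(2 * L) := Real.sqrt_pos.2 (by linarith)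
  have hrp : 0 < √L := Real.sqrt_pos.2 hL0
  have hrs : √L ^ 2 = L := Real.sq_sqrt hL0.le
  have hl0 : 0 ≤ Real.log L := Real.log_nonneg hL1
  have hl1 : Real.log L ≤ L := (Real.log_le_sub_one_of_pos hL0).trans (by linarith)
  have hl2 : Real.log L ≤ 2 * √L := by
    have h1 := Real.log_le_sub_one_of_pos hrp
    have h2 : Real.log L = 2 * Real.log √L := by rw [Real.log_sqrt hL0.le]; ring
    rw [h2]; linarith
  have hb2 : b ^ 2 = 2 * L - Real.log L + Real.log L ^ 2 / (8 * L) := by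
    have : b ^ 2 = √(2 * L) ^ 2 - Real.log L + Real.log L ^ 2 / (4 * √(2 * L) ^ 2) := by
      rw [hb]; field_simp; ring
    rw [this, hs]; ring
  have hb2u : b ^ 2 ≤ 2 * L - Real.log L + 1 / 2 := by
    have : Real.log L ^ 2 / (8 * L) ≤ 1 / 2 := by
      rw [div_le_iff₀ (by linarith)]
      nlinarith
    linarith
  have hb2l : 2 * L - Real.log L ≤ b ^ 2 := by
    have : 0 ≤ Real.log L ^ 2 / (8 * L) := by positivity
    linarith
  have hbpos : 0 < b := by
    rw [hb, sub_pos, div_lt_iff₀ (by positivity)]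
    nlinarith
  have hb1 : 1 ≤ b := by nlinarith
  have hexpL : Real.exp L = 2 * n := by rw [hL, Real.exp_log (by positivity)]
  have hexpl : Real.exp (Real.log L / 2) = √L := by
    rw [Real.exp_half, Real.exp_log hL0]
  have up := gauss_upper n b hbpos
  have lo := gauss_lower n hn b hb1
  have up' : n * (2 * (Real.exp (-b ^ 2 / 2) / b ^ 2)) ≤ 1 / √L := by
    have h1 : Real.exp (-b ^ 2 / 2) ≤ √L / (2 * n) := by
      rw [← hexpL, ← hexpl, ← Real.exp_sub]
      apply Real.exp_le_exp.2; linarith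
    have h2 : L ≤ b ^ 2 := by linarith
    calc n * (2 * (Real.exp (-b ^ 2 / 2) / b ^ 2)) ≤ n * (2 * (√L / (2 * n) / L)) := by gcongr
      _ = √L / L := by field_simp
      _ = 1 / √L := Real.sqrt_div_self'
  have lo' : 3 * √(2 * Real.pi) * Real.exp (b ^ 2 / 2 + 3 / 2) / n ≤
      6 * √(2 * Real.pi) * Real.exp (1 / 4 + 3 / 2) / √L := by
    have h1 : Real.exp (b ^ 2 / 2 + 3 / 2) ≤ 2 * n / √L * Real.exp (1 / 4 + 3 / 2) := by
      rw [← hexpL, ← hexpl, ← Real.exp_sub, ← Real.exp_add]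
      apply Real.exp_le_exp.2; linarith
    calc _ ≤ 3 * √(2 * Real.pi) * (2 * n / √L * Real.exp (1 / 4 + 3 / 2)) / n := by gcongr
      _ = _ := by field_simp; ring
  have p1 : 0 ≤ 1 / √L := by positivity
  have p2 : 0 ≤ 6 * √(2 * Real.pi) * Real.exp (1 / 4 + 3 / 2) / √L := by positivity
  rw [add_div, abs_le]
  constructor <;> linarith

lemma Avg_mono (n : ℕ) (F G : (Fin n → ℝ) → ℝ) (h : ∀ x, F x ≤ G x) : Avg n F ≤ Avg n G := by
  unfold Avg
  gcongr
  exact h _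

lemma Avg_affine (n : ℕ) (F : (Fin n → ℝ) → ℝ) (a c : ℝ) :
    Avg n (fun x => a * F x + c) = a * Avg n F + c := by
  unfold Avg
  rw [Finset.sum_add_distrib, ← Finset.mul_sum]
  simp
  field_simp

lemma compare (n : ℕ) (hn : 0 < n) (Q : Matrix (Fin n) (Fin n) ℝ) (hQ : Q * Q.transpose = 1)
    (s B : ℝ) (hB : 0 < B) (hs : ∀ i j, |Q i j| ≤ s) :
    |badBeta Q - ∫ x, ‖x‖ ∂(γn n)| ≤
      Real.log (2 * n) / B + n * (6 * (B * s) ^ 3 * (m3 + 1)) / B := by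
  have : Nonempty (Fin n) := ⟨⟨0, hn⟩⟩
  have h := lindeberg (ι := Fin n × Bool) (B * s) n (fun _ => 0) (fun p k => sgn p.2 * B * Q p.1 k)
    (by
      rintro ⟨i, b⟩ k
      have h1 : |sgn b| = 1 := by cases b <;> simp [sgn]
      rw [abs_mul, abs_mul, h1, abs_of_pos hB, one_mul]
      have := hs i k
      gcongr)
  set F := LSE (ι := Fin n × Bool) (fun _ => 0) (fun p k => sgn p.2 * B * Q p.1 k) with hF
  have hi : Integrable F (γn n) := LSE_integrable _ _
  have hb := fun x => softmax_bounds hn Q B hB x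
  rw [← hF] at hb
  have hbeta : badBeta Q = Avg n (fun x => ‖Q.mulVec x‖) := sum_cube n _
  have hQi : Integrable (fun x => ‖Q.mulVec x‖) (γn n) := by
    refine (hi.const_mul (1 / B)).mono' (by fun_prop) (Filter.Eventually.of_forall fun x => ?_)
    rw [norm_norm, one_div, ← div_eq_inv_mul, le_div_iff₀ hB, mul_comm]
    exact (hb x).1
  have a1 := Avg_mono n (fun x => B * ‖Q.mulVec x‖ + 0) F (fun x => by simpa using (hb x).1)
  have a2 := Avg_mono n F (fun x => B * ‖Q.mulVec x‖ + Real.log (2 * n)) (fun x => (hb x).2)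
  rw [Avg_affine n (fun x => ‖Q.mulVec x‖), ← hbeta] at a1 a2
  have b1 : B * ∫ x, ‖x‖ ∂(γn n) ≤ ∫ x, F x ∂(γn n) := by
    rw [← gauss_rot Q hQ, ← integral_const_mul]
    exact integral_mono (hQi.const_mul B) hi fun x => (hb x).1
  have b2 : ∫ x, F x ∂(γn n) ≤ B * ∫ x, ‖x‖ ∂(γn n) + Real.log (2 * n) := by
    have : ∫ x, (B * ‖Q.mulVec x‖ + Real.log (2 * n)) ∂(γn n) =
        B * ∫ x, ‖x‖ ∂(γn n) + Real.log (2 * n) := by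
      rw [integral_add (hQi.const_mul B) (integrable_const _), integral_const_mul, gauss_rot Q hQ]
      simp
    rw [← this]
    exact integral_mono hi ((hQi.const_mul B).add (integrable_const _)) fun x => (hb x).2
  rw [← add_div, le_div_iff₀ hB, ← abs_of_pos hB, ← abs_mul, abs_of_pos hB]
  rw [abs_le] at *
  constructor <;> nlinarith [h.1, h.2]

theorem stmt14 (M : ℝ) (hM : 0 < M) : ∃ C : ℝ, 0 < C ∧ ∃ N : ℕ, ∀ n : ℕ, N ≤ n →
    ∀ Q : Matrix (Fin n) (Fin n) ℝ,
      Q * Q.transpose = 1 →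
      (∀ i j, |Q i j| ≤ M / Real.sqrt n) →
      |badBeta Q -
          (Real.sqrt (2 * Real.log (2 * n)) -
            Real.log (Real.log (2 * n)) / (2 * Real.sqrt (2 * Real.log (2 * n))))| ≤
        C / Real.sqrt (Real.log n) := by
  have hm3 : 0 ≤ m3 := integral_nonneg fun t => by positivity
  set C1 := 1 + 6 * √(2 * Real.pi) * Real.exp (1 / 4 + 3 / 2) with hC1
  have hC1p : 0 < C1 := by positivity
  set C2 := 6 * M ^ 3 * (m3 + 1) * (10 ^ 5 * √2) with hC2
  have hC2p : 0 < C2 := by positivity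
  refine ⟨C1 + (1 + C2), by positivity, 2, fun n hn Q hQ hQM => ?_⟩
  have hn2 : (2:ℝ) ≤ n := by exact_mod_cast hn
  have hn0 : (0:ℝ) < n := by linarith
  obtain ⟨L, hL⟩ : ∃ L, L = Real.log (2 * n) := ⟨_, rfl⟩
  rw [← hL]
  have hL1 : 1 ≤ L := by
    rw [hL, Real.le_log_iff_exp_le (by positivity)]
    linarith [Real.exp_one_lt_d9]
  have hL0 : 0 < L := by linarith
  have g := gauss_asymp n (by omega) L hL hL1
  rw [← hC1] at g
  have c := compare n (by omega) Q hQ (M / √n) (L ^ 2) (by positivity) hQM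
  rw [← hL] at c
  have hrp : 0 < √L := Real.sqrt_pos.2 hL0
  have hr1 : 1 ≤ √L := Real.one_le_sqrt.2 hL1
  have hrs : √L ^ 2 = L := Real.sq_sqrt hL0.le
  have hsn : 0 < √(n:ℝ) := Real.sqrt_pos.2 hn0
  have hsn2 : √(n:ℝ) ^ 2 = n := Real.sq_sqrt hn0.le
  have t1 : L / L ^ 2 ≤ 1 / √L := by
    rw [div_le_div_iff₀ (by positivity) hrp]
    nlinarith
  have hL5 : L ^ 5 ≤ 10 ^ 5 * √2 * √n := by
    have h1 := Real.log_le_rpow_div (x := 2 * n) (ε := 1 / 10) (by positivity) (by norm_num)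
    rw [← hL] at h1
    have h2 : L ≤ 10 * (2 * (n:ℝ)) ^ ((1:ℝ) / 10) := by linarith
    calc L ^ 5 ≤ (10 * (2 * (n:ℝ)) ^ ((1:ℝ) / 10)) ^ 5 := by gcongr
      _ = 10 ^ 5 * (2 * (n:ℝ)) ^ ((1:ℝ) / 2) := by
        rw [mul_pow, ← Real.rpow_natCast ((2 * (n:ℝ)) ^ ((1:ℝ) / 10)), ← Real.rpow_mul (by positivity)]
        norm_num
      _ = _ := by
        rw [← Real.sqrt_eq_rpow, Real.sqrt_mul (by norm_num)]; ring
  have t2 : n * (6 * (L ^ 2 * (M / √n)) ^ 3 * (m3 + 1)) / L ^ 2 ≤ C2 / √L := by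
    have e : n * (6 * (L ^ 2 * (M / √n)) ^ 3 * (m3 + 1)) / L ^ 2 =
        6 * M ^ 3 * (m3 + 1) * (L ^ 4 / √n) := by
      have : (n:ℝ) * (6 * (L ^ 2 * (M / √n)) ^ 3 * (m3 + 1)) / L ^ 2 =
        √n ^ 2 * (6 * (L ^ 2 * (M / √n)) ^ 3 * (m3 + 1)) / L ^ 2 := by rw [hsn2]
      rw [this]
      field_simp
    rw [e, hC2, mul_div_assoc]
    refine mul_le_mul_of_nonneg_left ?_ (by positivity)
    rw [div_le_div_iff₀ hsn hrp]
    calc L ^ 4 * √L ≤ L ^ 4 * L := by gcongr; nlinarith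
      _ = L ^ 5 := by ring
      _ ≤ _ := hL5
  have hfin : (C1 + (1 + C2)) / √L ≤ (C1 + (1 + C2)) / √(Real.log n) := by
    have hlog : 0 < Real.log n := Real.log_pos (by linarith)
    have : Real.log n ≤ L := by
      rw [hL]; exact Real.log_le_log hn0 (by linarith)
    gcongr
  refine le_trans ?_ hfin
  have hsplit : (C1 + (1 + C2)) / √L = C1 / √L + (1 / √L + C2 / √L) := by
    ring
  rw [hsplit]
  rw [abs_le] at *
  constructor <;> linarith [g.1, g.2, c.1, c.2]
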